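/- Let 𝒯 be a finite undirected tree with weight function w : V(𝒯) → ℝ≥0, and let 𝒜 and ℬ be connected subgraphs of 𝒯 with V(𝒜) ∩ V(ℬ) ≠ ∅. If 𝒜 contains a centroid of (𝒯,w) and ℬ contains a centroid of (𝒯,w), then V(𝒜) ∩ V(ℬ) contains a centroid of (𝒯,w). -/

import Mathlib

open Filter Topology

universe u

variable {V : Type u}

/-- Rooted trees with vertices labelled by elements of `V`. -/
inductive RTree (V : Type u) : Type u where
  | node : V → List (RTree V) → RTree V

namespace RTree

/-- The root of a rooted tree. -/
def root : RTree V → V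
  | node r _ => r

/-- The subtrees rooted at the children of the root. -/
def children : RTree V → List (RTree V)
  | node _ ts => ts

/-- The list of pairs `(v, path from the root to v)` over all vertices `v` of the tree. -/
def pathsFrom : RTree V → List (V × List V)
  | node r ts =>
      (r, [r]) ::
        (ts.attach.map fun t => (t.1.pathsFrom.map fun p => (p.1, r :: p.2))).flatten
  decreasing_by
    simp only [RTree.node.sizeOf_spec]
    have := List.sizeOf_lt_of_mem t.2
    omega

/-- The vertex set of a rooted tree. -/
def vertSet (T : RTree V) : Set V := {v | ∃ p ∈ T.pathsFrom, p.1 = v}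

/-- `Path_T(v)`: the set of vertices on the path in `T` from the root to `v`
(including both endpoints). -/
def pathSet (T : RTree V) (v : V) : Set V := {x | ∃ p ∈ T.pathsFrom, p.1 = v ∧ x ∈ p.2}

/-- The depth of a vertex `v` in `T`; the root has depth 1. -/
noncomputable def depth (T : RTree V) (v : V) : ℕ := (T.pathSet v).ncard

/-- All subtrees of a rooted tree (including the tree itself). -/
def allSubtrees : RTree V → List (RTree V)
  | node r ts => node r ts :: (ts.attach.map fun t => t.1.allSubtrees).flatten
  decreasing_by
    simp only [RTree.node.sizeOf_spec]
    have := List.sizeOf_lt_of_mem t.2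
    omega

/-- Two rooted trees are equivalent (represent the same search tree) if they have
the same root-to-vertex paths. -/
def Equiv (T₁ T₂ : RTree V) : Prop := ∀ v, T₁.pathSet v = T₂.pathSet v

end RTree

/-- `x` and `y` are joined by a walk of `G` staying inside `s`. -/
def ReachIn (G : SimpleGraph V) (s : Set V) (x y : V) : Prop :=
  ∃ p : G.Walk x y, ∀ v ∈ p.support, v ∈ s

/-- The connected component of `x` in the subgraph of `G` induced by `s`. -/
def compIn (G : SimpleGraph V) (s : Set V) (x : V) : Set V := {y | ReachIn G s x y}

/-- The set of connected components of the subgraph of `G` induced by `s`. -/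
def comps (G : SimpleGraph V) (s : Set V) : Set (Set V) := {c | ∃ x ∈ s, c = compIn G s x}

/-- `s` induces a (nonempty) connected subgraph of `G`. -/
def ConnIn (G : SimpleGraph V) (s : Set V) : Prop :=
  s.Nonempty ∧ ∀ x ∈ s, ∀ y ∈ s, ReachIn G s x y

/-- The total weight of a set of vertices. -/
noncomputable def wsum (w : V → ℝ) (s : Set V) : ℝ := ∑ᶠ x ∈ s, w x

/-- `IsSearchTree G s T`: `T` is a search tree on the subgraph of `G` induced by `s`.
Its root `r` is a vertex of `s`, its vertex set is `s`, and the subtrees rooted at the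
children of `r` are search trees on the connected components of the induced subgraph
on `s \ {r}` (one subtree for each component). -/
inductive IsSearchTree (G : SimpleGraph V) : Set V → RTree V → Prop where
  | node {s : Set V} {r : V} {ts : List (RTree V)} :
      r ∈ s →
      (RTree.node r ts).vertSet = s →
      (∀ t ∈ ts, IsSearchTree G (compIn G (s \ {r}) t.root) t) →
      ts.Pairwise (fun t₁ t₂ => compIn G (s \ {r}) t₁.root ≠ compIn G (s \ {r}) t₂.root) →
      IsSearchTree G s (RTree.node r ts)

/-- The cost of a search tree: `∑_x w(x) · depth(x)`, the root having depth 1. -/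
noncomputable def cost (w : V → ℝ) (T : RTree V) : ℝ :=
  ∑ᶠ v ∈ T.vertSet, w v * (T.depth v : ℝ)

/-- The optimum cost of a search tree on the subgraph of `G` induced by `s`. -/
noncomputable def OPT (G : SimpleGraph V) (w : V → ℝ) (s : Set V) : ℝ :=
  sInf (cost w '' {T | IsSearchTree G s T})

/-- `v` is an `α`-centroid of the subgraph of `G` induced by `s` (with weights `w`):
every connected component of the induced subgraph on `s \ {v}` has weight at most
`α` times the weight of `s`. -/
def IsAlphaCentroid (G : SimpleGraph V) (w : V → ℝ) (α : ℝ) (s : Set V) (v : V) : Prop :=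
  v ∈ s ∧ ∀ x ∈ s \ {v}, wsum w (compIn G (s \ {v}) x) ≤ α * wsum w s

/-- `v` is a centroid of the subgraph of `G` induced by `s` (with weights `w`). -/
def IsCentroid (G : SimpleGraph V) (w : V → ℝ) (s : Set V) (v : V) : Prop :=
  v ∈ s ∧ ∀ x ∈ s \ {v}, wsum w (compIn G (s \ {v}) x) ≤ wsum w s / 2

/-- `T` is an `α`-centroid tree on the subgraph of `G` induced by `s`. -/
def IsAlphaCentroidTree (G : SimpleGraph V) (w : V → ℝ) (α : ℝ) (s : Set V) (T : RTree V) :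
    Prop :=
  IsSearchTree G s T ∧ ∀ t ∈ T.allSubtrees, IsAlphaCentroid G w α t.vertSet t.root

/-- `T` is a centroid tree on the subgraph of `G` induced by `s`. -/
def IsCentroidTree (G : SimpleGraph V) (w : V → ℝ) (s : Set V) (T : RTree V) : Prop :=
  IsSearchTree G s T ∧ ∀ t ∈ T.allSubtrees, IsCentroid G w t.vertSet t.root

/-- `cent(𝒯,w)`: the maximum cost of a centroid tree. -/
noncomputable def centCost (G : SimpleGraph V) (w : V → ℝ) (s : Set V) : ℝ :=
  sSup (cost w '' {T | IsCentroidTree G w s T})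

/-- `centᵅ(𝒯,w)`: the maximum cost of an `α`-centroid tree (`0` if none exists, since
`sSup ∅ = 0` in `ℝ`). -/
noncomputable def centCostA (G : SimpleGraph V) (w : V → ℝ) (α : ℝ) (s : Set V) : ℝ :=
  sSup (cost w '' {T | IsAlphaCentroidTree G w α s T})

/-- `b` is a child of `a` in the rooted tree `T`. -/
def ChildRel (T : RTree V) (a b : V) : Prop :=
  ∃ t ∈ T.allSubtrees, t.root = a ∧ ∃ t' ∈ t.children, t'.root = b

/-- Cutting a walk at the first vertex it has in common with `B`. -/
theorem exists_walk_first_mem {V : Type*} {G : SimpleGraph V} {B : Set V} {a c : V}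
    (p : G.Walk a c) (hc : c ∈ B) :
    ∃ m ∈ B, ∃ q : G.Walk a m, q.support ⊆ p.support ∧ ∀ v ∈ q.support, v ∈ B → v = m := by
  induction p with
  | nil => exact ⟨_, hc, .nil, by simp, by simp⟩
  | @cons u _ _ h p ih =>
    by_cases hu : u ∈ B
    · exact ⟨u, hu, .nil, by simp, by simp⟩
    · obtain ⟨m, hm, q, hqp, hq⟩ := ih hc
      refine ⟨m, hm, .cons h q, ?_, ?_⟩
      · simpa only [SimpleGraph.Walk.support_cons] using List.cons_subset_cons _ hqp
      · intro v hv hvB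
        rw [SimpleGraph.Walk.support_cons, List.mem_cons] at hv
        rcases hv with rfl | hv
        · exact absurd hvB hu
        · exact hq v hv hvB

/-- Two walks in an acyclic graph that meet only in their common endpoint `m` force every walk
between their other endpoints to pass through `m`. -/
theorem mem_support_of_walks_meet_at {V : Type*} {G : SimpleGraph V} (hG : G.IsAcyclic)
    {a b m : V} (q : G.Walk a m) (r : G.Walk m b)
    (h : ∀ v ∈ q.support, v ∈ r.support → v = m) (p : G.Walk a b) : m ∈ p.support := by
  classical
  have hpath : (q.bypass.append r.bypass).IsPath := by
    rw [SimpleGraph.Walk.isPath_def, SimpleGraph.Walk.support_append]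
    refine q.bypass_isPath.support_nodup.append r.bypass_isPath.support_nodup.tail ?_
    intro v hvq hvr
    obtain rfl := h v (q.support_bypass_subset_support hvq)
      (r.support_bypass_subset_support (List.mem_of_mem_tail hvr))
    have := r.bypass_isPath.support_nodup
    rw [← SimpleGraph.Walk.cons_tail_support, List.nodup_cons] at this
    exact this.1 hvr
  have heq : q.bypass.append r.bypass = p.bypass :=
    congrArg Subtype.val ((hG.subsingleton_path a b).elim ⟨_, hpath⟩ ⟨_, p.bypass_isPath⟩)
  apply p.support_bypass_subset_support
  rw [← heq, SimpleGraph.Walk.mem_support_append_iff]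
  exact .inl q.bypass.end_mem_support

theorem ReachIn.symm {V : Type*} {G : SimpleGraph V} {s : Set V} {x y : V}
    (h : ReachIn G s x y) : ReachIn G s y x := by
  obtain ⟨p, hp⟩ := h
  exact ⟨p.reverse, by simpa using hp⟩

theorem ReachIn.trans {V : Type*} {G : SimpleGraph V} {s : Set V} {x y z : V}
    (h₁ : ReachIn G s x y) (h₂ : ReachIn G s y z) : ReachIn G s x z := by
  obtain ⟨p, hp⟩ := h₁
  obtain ⟨q, hq⟩ := h₂
  refine ⟨p.append q, fun v hv => ?_⟩
  rw [SimpleGraph.Walk.mem_support_append_iff] at hv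
  exact hv.elim (hp v) (hq v)

theorem compIn_subset_of_notMem {V : Type*} {G : SimpleGraph V} {s : Set V} {x a : V}
    (ha : a ∉ compIn G s x) : compIn G s x ⊆ compIn G (Set.univ \ {a}) x := by
  classical
  rintro y ⟨p, hp⟩
  refine ⟨p, fun v hv => ⟨trivial, ?_⟩⟩
  rintro rfl
  exact ha ⟨p.takeUntil v hv, fun u hu => hp u (p.support_takeUntil_subset_support hv hu)⟩

theorem wsum_mono {V : Type*} [Finite V] {w : V → ℝ} (hw : ∀ x, 0 ≤ w x) {s t : Set V}
    (hst : s ⊆ t) : wsum w s ≤ wsum w t := by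
  classical
  have := Fintype.ofFinite V
  unfold wsum
  rw [finsum_mem_eq_toFinset_sum, finsum_mem_eq_toFinset_sum]
  exact Finset.sum_le_sum_of_subset_of_nonneg (Set.toFinset_subset_toFinset.2 hst)
    fun x _ _ => hw x

/-- A component not containing a centroid carries at most half of the weight. -/
theorem IsCentroid.wsum_compIn_le {V : Type*} [Finite V] {G : SimpleGraph V} {w : V → ℝ}
    (hw : ∀ x, 0 ≤ w x) {s : Set V} {x a : V} (hx : x ∈ s) (h : IsCentroid G w Set.univ a)
    (ha : a ∉ compIn G s x) : wsum w (compIn G s x) ≤ wsum w Set.univ / 2 := by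
  refine (wsum_mono hw (compIn_subset_of_notMem ha)).trans (h.2 x ⟨trivial, ?_⟩)
  rintro rfl
  exact ha ⟨.nil, by simpa using hx⟩

/-- A vertex separating two centroids is a centroid. -/
theorem IsCentroid.of_separates {V : Type*} [Finite V] {G : SimpleGraph V} {w : V → ℝ}
    (hw : ∀ x, 0 ≤ w x) {a b m : V} (ha : IsCentroid G w Set.univ a)
    (hb : IsCentroid G w Set.univ b) (hm : ∀ p : G.Walk a b, m ∈ p.support) :
    IsCentroid G w Set.univ m := by
  refine ⟨trivial, fun x hx => ?_⟩
  by_cases hax : a ∈ compIn G (Set.univ \ {m}) x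
  · refine hb.wsum_compIn_le hw hx fun hbx => ?_
    obtain ⟨p, hp⟩ := (ReachIn.symm hax).trans hbx
    exact (hp m (hm p)).2 rfl
  · exact ha.wsum_compIn_le hw hx hax

theorem centroids_intersection {V : Type} [Fintype V]
    (G : SimpleGraph V) (hG : G.IsTree) (w : V → ℝ) (hw : ∀ x, 0 ≤ w x)
    (A B : Set V) (hA : ConnIn G A) (hB : ConnIn G B) (hAB : (A ∩ B).Nonempty)
    (hcA : ∃ a ∈ A, IsCentroid G w Set.univ a)
    (hcB : ∃ b ∈ B, IsCentroid G w Set.univ b) :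
    ∃ c ∈ A ∩ B, IsCentroid G w Set.univ c := by
  obtain ⟨a, haA, ha⟩ := hcA
  obtain ⟨b, hbB, hb⟩ := hcB
  obtain ⟨c, hcA, hcB⟩ := hAB
  obtain ⟨p, hp⟩ := hA.2 a haA c hcA
  obtain ⟨m, hmB, q, hqp, hq⟩ := exists_walk_first_mem p hcB
  obtain ⟨r, hr⟩ := hB.2 m hmB b hbB
  exact ⟨m, ⟨hp m (hqp q.end_mem_support), hmB⟩, ha.of_separates hw hb
    (mem_support_of_walks_meet_at hG.isAcyclic q r fun v hvq hvr => hq v hvq (hr v hvr))⟩
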